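/- Let (X,d) be a metric space with a Borel measure m, x₀ ∈ X, r > 0, and write B_s = {y ∈ X : d(x₀,y) < s·r} and B = B_1; assume 0 < m(B_s) < ∞ for all s ∈ [1/2,1]. Let ν > 0, σ > 1, A ≥ 1, δ > 0 and 1/2 ≤ α < 1. Let u : X → ℝ be measurable with u ≥ δ on B, and assume: for every 1/2 ≤ s < t ≤ 1 and every q > 0, ((1/m(B_s)) ∫_{B_s} u^{−qσ} dm)^{1/(qσ)} ≤ [(A q · s/(t−s) + 1)(t/s)^{ν/2}]^{2/q} · ((1/m(B_t)) ∫_{B_t} u^{−q} dm)^{1/q}. Then there exists a constant c depending only on σ and ν such that for every p < 0, ess sup_{B_α} u^{p} ≤ ((c A |p| + 1)/(1−α))^{2σ/(σ−1)} · (1/m(B)) ∫_B u^{p} dm. -/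

import Mathlib

open MeasureTheory Metric

universe u

open Filter Topology in
/-- If the moments `∫ f ^ e n` grow at most like `C * K ^ e n` along exponents `e n → ∞`,
then `K` bounds the essential supremum of `f`. -/
lemma essSup_le_of_integral_rpow_le {X : Type*} [MeasurableSpace X] {μ : Measure X}
    [IsFiniteMeasure μ] [NeZero μ] {f : X → ℝ} (hf : 0 ≤ᵐ[μ] f) {e : ℕ → ℝ}
    (he : Tendsto e atTop atTop) {C K : ℝ} (hK : 0 ≤ K)
    (hint : ∀ n, Integrable (fun x => f x ^ e n) μ)
    (hle : ∀ n, ∫ x, f x ^ e n ∂μ ≤ C * K ^ e n) :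
    essSup f μ ≤ K := by
  refine le_of_forall_gt_imp_ge_of_dense fun M hM => ?_
  have hM0 : 0 < M := hK.trans_lt hM
  have hlim : Tendsto (fun n => C * (K / M) ^ e n) atTop (𝓝 0) := by
    have h := (tendsto_rpow_atTop_of_base_lt_one (K / M)
      (by linarith [div_nonneg hK hM0.le]) ((div_lt_one hM0).2 hM)).comp he
    simpa using h.const_mul C
  have hmeas : μ.real {x | M < f x} ≤ 0 := by
    refine ge_of_tendsto hlim ?_
    filter_upwards [he.eventually_gt_atTop 0] with n hn
    have hMe : 0 < M ^ e n := Real.rpow_pos_of_pos hM0 _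
    have hmarkov := mul_meas_ge_le_integral_of_nonneg
      (hf.mono fun x hx => Real.rpow_nonneg hx (e n)) (hint n) (M ^ e n)
    have hmono : μ.real {x | M < f x} ≤ μ.real {x | M ^ e n ≤ f x ^ e n} :=
      measureReal_mono fun x hx => Real.rpow_le_rpow hM0.le (le_of_lt hx) hn.le
    rw [Real.div_rpow hK hM0.le, ← mul_div_assoc, le_div_iff₀ hMe]
    nlinarith [hle n]
  have hae : f ≤ᵐ[μ] fun _ => M := by
    have h0 : μ {x | M < f x} = 0 :=
      (measureReal_eq_zero_iff).1 (le_antisymm hmeas measureReal_nonneg)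
    simpa [Filter.EventuallyLE, ae_iff] using h0
  have : (ae μ).NeBot := ae_neBot.2 (NeZero.ne μ)
  exact limsup_le_of_le (IsCoboundedUnder.of_frequently_ge (a := 0) hf.frequently) hae

lemma Real.log_one_add_le_two_mul_sqrt {x : ℝ} (hx : 0 ≤ x) :
    Real.log (1 + x) ≤ 2 * √x := by
  have h1 : 1 + x ≤ (1 + √x) ^ 2 := by nlinarith [Real.sq_sqrt hx, Real.sqrt_nonneg x]
  have h2 := Real.log_le_log (by linarith) h1
  rw [Real.log_pow] at h2
  have h3 := Real.log_le_sub_one_of_pos (x := 1 + √x) (by positivity)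
  push_cast at h2
  linarith

lemma sum_range_pow_le_inv {x : ℝ} (h0 : 0 ≤ x) (h1 : x < 1) (n : ℕ) :
    ∑ k ∈ Finset.range n, x ^ k ≤ (1 - x)⁻¹ :=
  (Summable.sum_le_tsum _ (fun k _ => pow_nonneg h0 k)
    (summable_geometric_of_lt_one h0 h1)).trans_eq (tsum_geometric_of_lt_one h0 h1)

lemma sum_range_two_div_pow_le {σ : ℝ} (hσ : 1 < σ) (n : ℕ) :
    ∑ k ∈ Finset.range n, 2 / σ ^ k ≤ 2 * σ / (σ - 1) := by
  have h := sum_range_pow_le_inv (x := σ⁻¹) (by positivity) (inv_lt_one_of_one_lt₀ hσ) n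
  have h2 : 2 * (1 - σ⁻¹)⁻¹ = 2 * σ / (σ - 1) := by
    have : σ - 1 ≠ 0 := by linarith
    have : σ ≠ 0 := by linarith
    field_simp
  calc ∑ k ∈ Finset.range n, 2 / σ ^ k = 2 * ∑ k ∈ Finset.range n, σ⁻¹ ^ k := by
        rw [Finset.mul_sum]; simp [div_eq_mul_inv]
    _ ≤ 2 * σ / (σ - 1) := by linarith

/-- The weighted logarithms of `1 + 2 E k / c`, where `E k = σ ^ k / ((1 - ρ) ρ ^ k)`, have
arbitrarily small sum when `c` is large, provided that `σ ρ > 1`. -/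
lemma exists_sum_log_le {σ ρ ε : ℝ} (hσ : 1 < σ) (hρ0 : 0 < ρ) (hρ1 : ρ < 1)
    (hσρ : 1 < σ * ρ) (hε : 0 < ε) :
    ∃ c : ℝ, 0 < c ∧ ∀ n : ℕ, ∑ k ∈ Finset.range n,
      2 / σ ^ k * Real.log (1 + 2 * (σ ^ k / ((1 - ρ) * ρ ^ k)) / c) ≤ ε := by
  have hρ : 0 < 1 - ρ := by linarith
  set x : ℝ := (√(σ * ρ))⁻¹ with hx
  have hx0 : 0 ≤ x := by positivity
  have hx1 : x < 1 := inv_lt_one_of_one_lt₀ (Real.lt_sqrt_of_sq_lt (by simpa using hσρ))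
  set T : ℝ := 4 * (1 - x)⁻¹ with hT
  have hT0 : 0 < T := by
    have : 0 < 1 - x := by linarith
    positivity
  refine ⟨2 / ((1 - ρ) * (ε / T) ^ 2), by positivity, fun n => ?_⟩
  have hterm : ∀ k : ℕ, 2 / σ ^ k * Real.log (1 + 2 * (σ ^ k / ((1 - ρ) * ρ ^ k)) /
      (2 / ((1 - ρ) * (ε / T) ^ 2))) ≤ 4 * (ε / T) * x ^ k := by
    intro k
    have hE : 2 * (σ ^ k / ((1 - ρ) * ρ ^ k)) / (2 / ((1 - ρ) * (ε / T) ^ 2))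
        = (ε / T * (σ ^ k * x ^ k)) ^ 2 := by
      have hx2 : x ^ 2 = (σ * ρ)⁻¹ := by
        rw [hx, inv_pow, Real.sq_sqrt (by positivity)]
      have hxk : (x ^ k) ^ 2 = ((σ * ρ) ^ k)⁻¹ := by
        rw [← pow_mul, mul_comm k 2, pow_mul, hx2, inv_pow]
      rw [mul_pow, mul_pow (σ ^ k), hxk, mul_pow]
      field_simp
    have hlog := Real.log_one_add_le_two_mul_sqrt (sq_nonneg (ε / T * (σ ^ k * x ^ k)))
    rw [Real.sqrt_sq (by positivity)] at hlog
    rw [hE]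
    calc _ ≤ 2 / σ ^ k * (2 * (ε / T * (σ ^ k * x ^ k))) := by gcongr
      _ = 4 * (ε / T) * x ^ k := by field_simp; ring
  calc _ ≤ ∑ k ∈ Finset.range n, 4 * (ε / T) * x ^ k := Finset.sum_le_sum fun k _ => hterm k
    _ = 4 * (ε / T) * ∑ k ∈ Finset.range n, x ^ k := by rw [Finset.mul_sum]
    _ ≤ 4 * (ε / T) * (1 - x)⁻¹ := by
        gcongr; exact sum_range_pow_le_inv hx0 hx1 n
    _ = ε := by
        rw [show 4 * (ε / T) * (1 - x)⁻¹ = ε / T * T by rw [hT]; ring]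
        field_simp

/-- Bound for the constant of one iteration step between the radii `s` and
`t = s + (1 - α) d`. -/
lemma moser_step_factor_le {ν α s t d y c E : ℝ} (hν : 0 < ν) (hα : 1 / 2 ≤ α) (hα1 : α < 1)
    (hs : 1 / 2 ≤ s) (hs1 : s ≤ 1) (hd : 0 < d) (hdν : ν * d ≤ Real.log 2)
    (hst : t - s = (1 - α) * d) (hy : 0 ≤ y) (hE : 0 ≤ E) (hc : 0 < c) :
    (y * (E * d) * (s / (t - s)) + 1) * (t / s) ^ (ν / 2) ≤
      (c * y + 1) / (1 - α) / √2 * (1 + 2 * E / c) := by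
  have ha : 0 < 1 - α := by linarith
  have hs0 : 0 < s := by linarith
  have ht0 : 0 < t := by nlinarith [mul_pos ha hd]
  have h1 : y * (E * d) * (s / (t - s)) + 1 ≤ (1 - α)⁻¹ * (1 / 2 + y * E) := by
    rw [hst]
    have e1 : y * (E * d) * (s / ((1 - α) * d)) + 1 = (1 - α)⁻¹ * ((1 - α) + y * E * s) := by
      field_simp
      ring
    rw [e1]
    refine mul_le_mul_of_nonneg_left ?_ (by positivity)
    nlinarith [mul_nonneg hy hE]
  have h3 : (t / s) ^ (ν / 2) ≤ √2 := by
    have hts : t / s ≤ Real.exp d := by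
      rw [div_le_iff₀ hs0]
      nlinarith [Real.add_one_le_exp d]
    calc (t / s) ^ (ν / 2) ≤ Real.exp d ^ (ν / 2) := by gcongr
      _ = Real.exp (d * (ν / 2)) := (Real.exp_mul _ _).symm
      _ ≤ Real.exp (Real.log 2 * (1 / 2)) := Real.exp_le_exp.2 (by linarith)
      _ = √2 := by rw [Real.exp_mul, Real.exp_log (by norm_num), Real.sqrt_eq_rpow]
  have h4 : 1 + 2 * (y * E) ≤ (c * y + 1) * (1 + 2 * E / c) := by
    have : (c * y + 1) * (1 + 2 * E / c) = 1 + 2 * (y * E) + (c * y + 2 * E / c) := by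
      field_simp; ring
    rw [this]
    have : 0 ≤ c * y + 2 * E / c := by positivity
    linarith
  calc _ ≤ (1 - α)⁻¹ * (1 / 2 + y * E) * √2 := by gcongr
    _ = (1 - α)⁻¹ / √2 * (1 + 2 * (y * E)) := by
        have : √2 ^ 2 = 2 := Real.sq_sqrt (by norm_num)
        field_simp
        rw [this]
    _ ≤ (1 - α)⁻¹ / √2 * ((c * y + 1) * (1 + 2 * E / c)) := by gcongr
    _ = _ := by ring

/-- Iterating `a (n + 1) ≤ F n ^ (2 / σ ^ n) * a n` when `F n ≤ (D / √2) * G n` and the weighted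
logarithms of `G` sum up to at most `σ / (σ - 1) * log 2`. -/
lemma le_rpow_mul_of_moser_step {σ D : ℝ} {a F G : ℕ → ℝ} (hσ : 1 < σ) (hD : 2 ≤ D)
    (hF : ∀ n, 0 ≤ F n) (hG : ∀ n, 0 < G n)
    (hFG : ∀ n, F n ≤ D / √2 * G n)
    (hsum : ∀ n : ℕ, ∑ k ∈ Finset.range n, 2 / σ ^ k * Real.log (G k) ≤
      σ / (σ - 1) * Real.log 2)
    (hstep : ∀ n, a (n + 1) ≤ F n ^ (2 / σ ^ n) * a n) (hann : ∀ n, 0 ≤ a n) (n : ℕ) :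
    a n ≤ D ^ (2 * σ / (σ - 1)) * a 0 := by
  have ha0 := hann 0
  have hD0 : 0 < D := by linarith
  have hb : 0 < D / √2 := by positivity
  have key : ∀ n, a n ≤ Real.exp (∑ k ∈ Finset.range n,
      2 / σ ^ k * (Real.log (D / √2) + Real.log (G k))) * a 0 := by
    intro n
    induction n with
    | zero => simp
    | succ n ih =>
      have hF' : F n ^ (2 / σ ^ n) ≤
          Real.exp (2 / σ ^ n * (Real.log (D / √2) + Real.log (G n))) := by
        rw [← Real.log_mul hb.ne' (hG n).ne', mul_comm (2 / σ ^ n),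
          ← Real.rpow_def_of_pos (mul_pos hb (hG n))]
        exact Real.rpow_le_rpow (hF n) (hFG n) (by positivity)
      rw [Finset.sum_range_succ, Real.exp_add]
      calc a (n + 1) ≤ F n ^ (2 / σ ^ n) * a n := hstep n
        _ ≤ _ := mul_le_mul hF' ih (hann n) (Real.exp_pos _).le
        _ = _ := by ring
  refine (key n).trans ?_
  rw [Real.rpow_def_of_pos hD0]
  gcongr
  have hlogb : Real.log (D / √2) = Real.log D - Real.log 2 / 2 := by
    rw [Real.log_div hD0.ne' (by positivity), Real.log_sqrt (by norm_num)]
  have hlogb0 : 0 ≤ Real.log (D / √2) := by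
    have := Real.log_le_log (by norm_num) hD
    have := Real.log_nonneg (x := 2) (by norm_num)
    rw [hlogb]
    linarith
  calc _ = (∑ k ∈ Finset.range n, 2 / σ ^ k) * Real.log (D / √2) +
        ∑ k ∈ Finset.range n, 2 / σ ^ k * Real.log (G k) := by
        rw [Finset.sum_mul, ← Finset.sum_add_distrib]
        exact Finset.sum_congr rfl fun k _ => by ring
    _ ≤ 2 * σ / (σ - 1) * Real.log (D / √2) + σ / (σ - 1) * Real.log 2 := by
        gcongr
        · exact sum_range_two_div_pow_le hσ n
        · exact hsum n
    _ = Real.log D * (2 * σ / (σ - 1)) := by rw [hlogb]; ring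

/-- Moser iteration for negative exponents (Lemma 2): the constant `c` depends
only on `σ` and `ν`. -/
theorem moser_iteration_neg (σ ν : ℝ) (hσ : 1 < σ) (hν : 0 < ν) :
    ∃ c : ℝ, ∀ (X : Type u) [MetricSpace X] [MeasurableSpace X] [BorelSpace X]
      (m : Measure X) (x₀ : X) (r : ℝ), 0 < r →
      (∀ s : ℝ, 1/2 ≤ s → s ≤ 1 → 0 < m (ball x₀ (s * r)) ∧ m (ball x₀ (s * r)) < ⊤) →
      ∀ A δ α : ℝ, 1 ≤ A → 0 < δ → 1/2 ≤ α → α < 1 →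
      ∀ u : X → ℝ, Measurable u →
      (∀ x ∈ ball x₀ r, δ ≤ u x) →
      (∀ s t q : ℝ, 1/2 ≤ s → s < t → t ≤ 1 → 0 < q →
        ((m (ball x₀ (s * r))).toReal⁻¹ *
            ∫ x in ball x₀ (s * r), u x ^ (-(q * σ)) ∂m) ^ (1 / (q * σ))
          ≤ ((A * q * (s / (t - s)) + 1) * (t / s) ^ (ν / 2)) ^ (2 / q) *
            ((m (ball x₀ (t * r))).toReal⁻¹ *
              ∫ x in ball x₀ (t * r), u x ^ (-q) ∂m) ^ (1 / q)) →
      ∀ p : ℝ, p < 0 →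
        essSup (fun x => u x ^ p) (m.restrict (ball x₀ (α * r)))
          ≤ ((c * A * |p| + 1) / (1 - α)) ^ (2 * σ / (σ - 1)) *
            ((m (ball x₀ r)).toReal⁻¹ * ∫ x in ball x₀ r, u x ^ p ∂m) := by
  have hlog2 : 0 < Real.log 2 := Real.log_pos (by norm_num)
  have hσ0 : 0 < σ := by linarith
  obtain ⟨ρ, hρl, hρ1⟩ : ∃ ρ, max σ⁻¹ (1 - Real.log 2 / ν) < ρ ∧ ρ < 1 := by
    refine exists_between (max_lt (inv_lt_one_of_one_lt₀ hσ) ?_)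
    have : 0 < Real.log 2 / ν := by positivity
    linarith
  obtain ⟨hρσ, hρν⟩ := max_lt_iff.1 hρl
  have hρ0 : 0 < ρ := (inv_pos.2 hσ0).trans hρσ
  have hσρ : 1 < σ * ρ := by rwa [inv_lt_iff_one_lt_mul₀' hσ0] at hρσ
  have hνρ : ν * (1 - ρ) ≤ Real.log 2 := by
    have : 1 - ρ ≤ Real.log 2 / ν := by linarith
    rwa [le_div_iff₀' hν] at this
  have hσ1 : 0 < σ - 1 := by linarith
  obtain ⟨c, hc, hsum⟩ := exists_sum_log_le (ε := σ / (σ - 1) * Real.log 2) hσ hρ0 hρ1 hσρ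
    (by positivity)
  refine ⟨c, ?_⟩
  intro X _ _ _ m x₀ r hr hm A δ α hA hδ hα hα1 u hu hδu hrev p hp
  have hα0 : 0 < 1 - α := by linarith
  have hρ' : 0 < 1 - ρ := by linarith
  obtain ⟨q, rfl⟩ : ∃ q, p = -q := ⟨-p, by ring⟩
  have hq : 0 < q := by linarith
  rw [abs_neg, abs_of_pos hq]
  set s : ℕ → ℝ := fun n => α + (1 - α) * ρ ^ n with hs
  have hρn : ∀ n, 0 < ρ ^ n := fun n => pow_pos hρ0 n
  have hρn1 : ∀ n, ρ ^ n ≤ 1 := fun n => pow_le_one₀ hρ0.le hρ1.le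
  have hsα : ∀ n, α ≤ s n := fun n => by
    have := mul_pos hα0 (hρn n)
    simp only [hs]; linarith
  have hs1 : ∀ n, s n ≤ 1 := fun n => by
    have := mul_le_mul_of_nonneg_left (hρn1 n) hα0.le
    simp only [hs]; linarith
  have hsub : ∀ n, s n - s (n + 1) = (1 - α) * ((1 - ρ) * ρ ^ n) := fun n => by
    simp only [hs, pow_succ]; ring
  have hupos : ∀ t ≤ 1, ∀ x ∈ ball x₀ (t * r), δ ≤ u x := fun t ht x hx =>
    hδu x (ball_subset_ball (by nlinarith) hx)
  have hnn : ∀ t ≤ 1, ∀ e : ℝ, 0 ≤ ∫ x in ball x₀ (t * r), u x ^ e ∂m := fun t ht e =>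
    setIntegral_nonneg measurableSet_ball fun x hx =>
      Real.rpow_nonneg (hδ.le.trans (hupos t ht x hx)) _
  have hint : ∀ t, 1 / 2 ≤ t → t ≤ 1 → ∀ e : ℝ, 0 < e →
      IntegrableOn (fun x => u x ^ (-e)) (ball x₀ (t * r)) m := by
    intro t ht ht1 e he
    refine Measure.integrableOn_of_bounded (M := δ ^ (-e)) (hm t ht ht1).2.ne
      (hu.pow_const _).aestronglyMeasurable ?_
    refine (ae_restrict_iff' measurableSet_ball).2 (Filter.Eventually.of_forall fun x hx => ?_)
    have hux := hupos t ht1 x hx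
    rw [Real.norm_of_nonneg (Real.rpow_nonneg (hδ.le.trans hux) _)]
    exact Real.rpow_le_rpow_of_nonpos hδ hux (by linarith)
  set I : ℕ → ℝ := fun n => (m (ball x₀ (s n * r))).toReal⁻¹ *
    ∫ x in ball x₀ (s n * r), u x ^ (-(q * σ ^ n)) ∂m with hI
  have hI0 : ∀ n, 0 ≤ I n := fun n =>
    mul_nonneg (inv_nonneg.2 ENNReal.toReal_nonneg) (hnn _ (hs1 n) _)
  set E : ℕ → ℝ := fun n => σ ^ n / ((1 - ρ) * ρ ^ n) with hE
  set F : ℕ → ℝ := fun n => (A * (q * σ ^ n) * (s (n + 1) / (s n - s (n + 1))) + 1) *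
    (s n / s (n + 1)) ^ (ν / 2) with hF
  have hspos : ∀ n, 0 < s n := fun n => by linarith [hsα n]
  have hF0 : ∀ n, 0 ≤ F n := fun n => by
    have h1 := hspos n
    have h2 := hspos (n + 1)
    have h3 := hρn n
    simp only [hF, hsub]
    positivity
  have hFle : ∀ n, F n ≤ (c * A * q + 1) / (1 - α) / √2 * (1 + 2 * E n / c) := fun n => by
    have hd : 0 < (1 - ρ) * ρ ^ n := mul_pos hρ' (hρn n)
    have h := moser_step_factor_le (E := E n) (y := A * q) hν hα hα1
      (hα.trans (hsα (n + 1))) (hs1 (n + 1)) hd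
      (by nlinarith [hρn1 n, mul_pos hν hρ']) (hsub n) (by positivity) (by positivity) hc
    have hEd : E n * ((1 - ρ) * ρ ^ n) = σ ^ n := by
      simp only [hE]; exact div_mul_cancel₀ _ hd.ne'
    rw [hEd, ← mul_assoc c A q] at h
    simpa only [hF, mul_assoc] using h
  have hstep : ∀ n, I (n + 1) ^ (1 / σ ^ (n + 1)) ≤ F n ^ (2 / σ ^ n) * I n ^ (1 / σ ^ n) := by
    intro n
    have hlt : s (n + 1) < s n := by
      have := mul_pos hα0 (mul_pos hρ' (hρn n))
      linarith [hsub n]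
    have hqn : 0 < q * σ ^ n := by positivity
    have h := hrev (s (n + 1)) (s n) (q * σ ^ n) (hα.trans (hsα _)) hlt (hs1 n) hqn
    rw [mul_assoc q, ← pow_succ] at h
    have h' := Real.rpow_le_rpow (Real.rpow_nonneg (hI0 (n + 1)) _) h hq.le
    rw [Real.mul_rpow (Real.rpow_nonneg (hF0 n) _) (Real.rpow_nonneg (hI0 n) _),
      ← Real.rpow_mul (hI0 (n + 1)), ← Real.rpow_mul (hF0 n), ← Real.rpow_mul (hI0 n)] at h'
    convert h' using 2 <;> field_simp
  set D : ℝ := (c * A * q + 1) / (1 - α) with hD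
  have hD2 : 2 ≤ D := by
    rw [hD, le_div_iff₀ hα0]
    have : 0 < c * A * q := by positivity
    linarith
  have hbound := le_rpow_mul_of_moser_step (a := fun n => I n ^ (1 / σ ^ n)) hσ hD2 hF0
    (fun n => by have := hρn n; positivity) hFle hsum hstep
    (fun n => Real.rpow_nonneg (hI0 n) _)
  have hI00 : I 0 ^ (1 / σ ^ 0) = (m (ball x₀ r)).toReal⁻¹ * ∫ x in ball x₀ r, u x ^ (-q) ∂m := by
    simp [hI, hs]
  simp only [hI00] at hbound
  set K := D ^ (2 * σ / (σ - 1)) * ((m (ball x₀ r)).toReal⁻¹ * ∫ x in ball x₀ r, u x ^ (-q) ∂m)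
    with hKdef
  have hK : 0 ≤ K := (Real.rpow_nonneg (hI0 0) _).trans (hbound 0)
  have hmα := hm α hα hα1.le
  have : IsFiniteMeasure (m.restrict (ball x₀ (α * r))) := ⟨by simpa using hmα.2⟩
  have : NeZero (m.restrict (ball x₀ (α * r))) :=
    ⟨by simpa [Measure.restrict_eq_zero] using hmα.1.ne'⟩
  have hαpos : ∀ᵐ x ∂m.restrict (ball x₀ (α * r)), 0 ≤ u x :=
    (ae_restrict_iff' measurableSet_ball).2 (Filter.Eventually.of_forall fun x hx =>
      hδ.le.trans (hupos α hα1.le x hx))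
  have hpow : ∀ n : ℕ, (fun x => u x ^ (-(q * σ ^ n)))
      =ᵐ[m.restrict (ball x₀ (α * r))] fun x => (u x ^ (-q)) ^ (σ ^ n) := fun n => by
    filter_upwards [hαpos] with x hx
    rw [← Real.rpow_mul hx, neg_mul]
  refine essSup_le_of_integral_rpow_le (e := fun n => σ ^ n)
    (C := (m (ball x₀ r)).toReal) (hαpos.mono fun x hx => Real.rpow_nonneg hx _)
    (tendsto_pow_atTop_atTop_of_one_lt hσ) hK (fun n => ?_) fun n => ?_
  · exact (hint α hα hα1.le (q * σ ^ n) (by positivity)).congr (hpow n)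
  · rw [← integral_congr_ae (hpow n)]
    have hmn := hm (s n) (hα.trans (hsα n)) (hs1 n)
    have hm1 : m (ball x₀ r) < ⊤ := by simpa using (hm 1 (by norm_num) le_rfl).2
    have hIK : I n ≤ K ^ σ ^ n := by
      have h := Real.rpow_le_rpow (Real.rpow_nonneg (hI0 n) _) (hbound n)
        (pow_pos hσ0 n).le
      rwa [← Real.rpow_mul (hI0 n), one_div_mul_cancel (pow_pos hσ0 n).ne', Real.rpow_one] at h
    calc ∫ x in ball x₀ (α * r), u x ^ (-(q * σ ^ n)) ∂m
        ≤ ∫ x in ball x₀ (s n * r), u x ^ (-(q * σ ^ n)) ∂m := by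
          refine setIntegral_mono_set
            (hint (s n) (hα.trans (hsα n)) (hs1 n) (q * σ ^ n) (by positivity)) ?_
            (ball_subset_ball (by nlinarith [hsα n])).eventuallyLE
          exact (ae_restrict_iff' measurableSet_ball).2 (Filter.Eventually.of_forall
            fun x hx => Real.rpow_nonneg (hδ.le.trans (hupos _ (hs1 n) x hx)) _)
      _ = (m (ball x₀ (s n * r))).toReal * I n := by
          rw [hI, mul_inv_cancel_left₀ (ENNReal.toReal_pos hmn.1.ne' hmn.2.ne).ne']
      _ ≤ (m (ball x₀ r)).toReal * K ^ σ ^ n := by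
          refine mul_le_mul (ENNReal.toReal_mono hm1.ne (measure_mono (ball_subset_ball ?_)))
            hIK (hI0 n) ENNReal.toReal_nonneg
          nlinarith [hs1 n]
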